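/- Let p > 0, and suppose the potential V satisfies ‖ΔV‖_{L^∞([0,T]×𝕋^d)} < (2/T²)·(1/p). If (u,m) is a smooth solution of the first-order planning system, then, setting ε := 2 − p T² ‖ΔV‖_{L^∞([0,T]×𝕋^d)} (so that 0 < ε ≤ 2), for every t ∈ [0,T] one has ∫_{𝕋^d} m(t,x)^{p+1} dx ≤ (2/ε) ( ∫_{𝕋^d} m_0(x)^{p+1} dx + ∫_{𝕋^d} m_T(x)^{p+1} dx ). In particular, max_{t∈[0,T]} ‖m(t,·)‖_{L^{p+1}(𝕋^d)} ≤ C for a constant C depending only on T, V, m_0, m_T, and p. -/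

import Mathlib

open MeasureTheory Real Set

/-- Partial derivative in the `i`-th coordinate direction. -/
noncomputable def pd {d : ℕ} (i : Fin d) (f : (Fin d → ℝ) → ℝ) (x : Fin d → ℝ) : ℝ :=
  fderiv ℝ f x (Pi.single i 1)

/-- Laplacian in the space variable. -/
noncomputable def lap {d : ℕ} (f : (Fin d → ℝ) → ℝ) (x : Fin d → ℝ) : ℝ :=
  ∑ i, pd i (pd i f) x

/-- The `L^∞` norm of `ΔV` on `[0,T] × 𝕋^d` (for continuous periodic `V`, the sup of `|ΔV|`). -/
noncomputable def lapVsup (d : ℕ) (T : ℝ) (V : ℝ → (Fin d → ℝ) → ℝ) : ℝ :=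
  sSup {y : ℝ | ∃ t ∈ Set.Icc (0 : ℝ) T, ∃ x : Fin d → ℝ, y = |lap (V t) x|}


open scoped ContDiff Topology

noncomputable def DD {d : ℕ} (v : ℝ × (Fin d → ℝ)) (G : ℝ × (Fin d → ℝ) → ℝ)
    (q : ℝ × (Fin d → ℝ)) : ℝ := fderiv ℝ G q v

abbrev ee {d : ℕ} (i : Fin d) : ℝ × (Fin d → ℝ) := (0, Pi.single i 1)

abbrev tt (d : ℕ) : ℝ × (Fin d → ℝ) := (1, 0)

abbrev SS (d : ℕ) (T : ℝ) : Set (ℝ × (Fin d → ℝ)) := Set.Ioo (0 : ℝ) T ×ˢ Set.univ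

def Per {d : ℕ} (G : ℝ × (Fin d → ℝ) → ℝ) : Prop :=
  ∀ (t : ℝ) (x : Fin d → ℝ) (k : Fin d → ℤ), G (t, x + fun i => (k i : ℝ)) = G (t, x)

lemma SS_open (d : ℕ) (T : ℝ) : IsOpen (SS d T) := isOpen_Ioo.prod isOpen_univ

lemma Per.DD {d : ℕ} {G : ℝ × (Fin d → ℝ) → ℝ} (h : Per G) (v : ℝ × (Fin d → ℝ)) :
    Per (DD v G) := by
  intro t x k
  have h1 : (fun q => G (q + ((0 : ℝ), fun i => (k i : ℝ)))) = G := by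
    funext ⟨s, y⟩
    simpa using h s y k
  have h2 := fderiv_comp_add_right (𝕜 := ℝ) (f := G) (x := (t, x)) ((0 : ℝ), fun i => (k i : ℝ))
  rw [h1] at h2
  simp only [_root_.DD]
  rw [h2]
  simp

lemma DD_smooth {d : ℕ} {T : ℝ} {G : ℝ × (Fin d → ℝ) → ℝ} (h : ContDiffOn ℝ ∞ G (SS d T))
    (v : ℝ × (Fin d → ℝ)) : ContDiffOn ℝ ∞ (DD v G) (SS d T) := by
  have h1 : ContDiffOn ℝ ∞ (fderiv ℝ G) (SS d T) :=
    h.fderiv_of_isOpen (SS_open d T) (by simp)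
  exact h1.clm_apply contDiffOn_const

lemma DD_cont {d : ℕ} {T : ℝ} {G : ℝ × (Fin d → ℝ) → ℝ} (h : ContDiffOn ℝ 1 G (SS d T))
    (v : ℝ × (Fin d → ℝ)) : ContinuousOn (DD v G) (SS d T) := by
  have h1 : ContinuousOn (fderiv ℝ G) (SS d T) :=
    h.continuousOn_fderiv_of_isOpen (SS_open d T) le_rfl
  exact h1.clm_apply continuousOn_const

lemma C1_diff {d : ℕ} {T : ℝ} {G : ℝ × (Fin d → ℝ) → ℝ} (h : ContDiffOn ℝ 1 G (SS d T))
    {q : ℝ × (Fin d → ℝ)} (hq : q ∈ SS d T) : DifferentiableAt ℝ G q :=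
  (h.contDiffAt ((SS_open d T).mem_nhds hq)).differentiableAt (by simp)

lemma C1_of {d : ℕ} {T : ℝ} {G : ℝ × (Fin d → ℝ) → ℝ} (h : ContDiffOn ℝ ∞ G (SS d T)) :
    ContDiffOn ℝ 1 G (SS d T) := h.of_le (by norm_cast)

lemma DD_congr {d : ℕ} {T : ℝ} {G H : ℝ × (Fin d → ℝ) → ℝ} (h : ∀ q ∈ SS d T, G q = H q)
    (v : ℝ × (Fin d → ℝ)) : ∀ q ∈ SS d T, DD v G q = DD v H q := by
  intro q hq
  have : G =ᶠ[𝓝 q] H := Filter.eventually_of_mem ((SS_open d T).mem_nhds hq) h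
  simp [DD, this.fderiv_eq]

lemma DD_comm {d : ℕ} {T : ℝ} {G : ℝ × (Fin d → ℝ) → ℝ} (h : ContDiffOn ℝ ∞ G (SS d T))
    (v w : ℝ × (Fin d → ℝ)) : ∀ q ∈ SS d T, DD v (DD w G) q = DD w (DD v G) q := by
  intro q hq
  have h1 : ContDiffOn ℝ ∞ (fderiv ℝ G) (SS d T) :=
    h.fderiv_of_isOpen (SS_open d T) (by simp)
  have h2 : DifferentiableAt ℝ (fderiv ℝ G) q :=
    (h1.contDiffAt ((SS_open d T).mem_nhds hq)).differentiableAt (by simp)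
  have h3 : ∀ v w, DD v (DD w G) q = fderiv ℝ (fderiv ℝ G) q v w := by
    intro v w
    have : HasFDerivAt (fun q => fderiv ℝ G q w) _ q := h2.hasFDerivAt.clm_apply (hasFDerivAt_const w q)
    unfold DD
    rw [this.fderiv]
    simp
  rw [h3, h3]
  have h4 : IsSymmSndFDerivAt ℝ G q :=
    (h.contDiffAt ((SS_open d T).mem_nhds hq)).isSymmSndFDerivAt (by simp; norm_cast)
  exact h4 v w

lemma DD_mul {d : ℕ} {T : ℝ} {G H : ℝ × (Fin d → ℝ) → ℝ} (hG : ContDiffOn ℝ 1 G (SS d T))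
    (hH : ContDiffOn ℝ 1 H (SS d T))
    (v : ℝ × (Fin d → ℝ)) : ∀ q ∈ SS d T,
      DD v (fun q => G q * H q) q = G q * DD v H q + DD v G q * H q := by
  intro q hq
  unfold DD
  rw [fderiv_fun_mul (C1_diff hG hq) (C1_diff hH hq)]
  simp [mul_comm]

lemma DD_add {d : ℕ} {T : ℝ} {G H : ℝ × (Fin d → ℝ) → ℝ} (hG : ContDiffOn ℝ 1 G (SS d T))
    (hH : ContDiffOn ℝ 1 H (SS d T))
    (v : ℝ × (Fin d → ℝ)) : ∀ q ∈ SS d T,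
      DD v (fun q => G q + H q) q = DD v G q + DD v H q := by
  intro q hq
  unfold DD
  rw [fderiv_fun_add (C1_diff hG hq) (C1_diff hH hq)]
  simp

lemma DD_sub {d : ℕ} {T : ℝ} {G H : ℝ × (Fin d → ℝ) → ℝ} (hG : ContDiffOn ℝ 1 G (SS d T))
    (hH : ContDiffOn ℝ 1 H (SS d T))
    (v : ℝ × (Fin d → ℝ)) : ∀ q ∈ SS d T,
      DD v (fun q => G q - H q) q = DD v G q - DD v H q := by
  intro q hq
  unfold DD
  rw [fderiv_fun_sub (C1_diff hG hq) (C1_diff hH hq)]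
  simp

lemma DD_sum {d : ℕ} {T : ℝ} {ι : Type} [Fintype ι] {G : ι → ℝ × (Fin d → ℝ) → ℝ}
    (hG : ∀ i, ContDiffOn ℝ 1 (G i) (SS d T))
    (v : ℝ × (Fin d → ℝ)) : ∀ q ∈ SS d T,
      DD v (fun q => ∑ i, G i q) q = ∑ i, DD v (G i) q := by
  intro q hq
  unfold DD
  rw [fderiv_fun_sum (fun i _ => C1_diff (hG i) hq)]
  simp

lemma hasDerivAt_slice {d : ℕ} {G : ℝ × (Fin d → ℝ) → ℝ} {t : ℝ} {x : Fin d → ℝ}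
    (h : DifferentiableAt ℝ G (t, x)) : HasDerivAt (fun s => G (s, x)) (DD (tt d) G (t, x)) t := by
  have h1 : HasDerivAt (fun s : ℝ => (s, x)) ((1 : ℝ), (0 : Fin d → ℝ)) t :=
    (hasDerivAt_id t).prodMk (hasDerivAt_const t x)
  exact h.hasFDerivAt.comp_hasDerivAt t h1

lemma hasFDerivAt_slice {d : ℕ} {G : ℝ × (Fin d → ℝ) → ℝ} {t : ℝ} {x : Fin d → ℝ}
    (h : DifferentiableAt ℝ G (t, x)) : HasFDerivAt (fun y => G (t, y))
      ((fderiv ℝ G (t, x)).comp (ContinuousLinearMap.inr ℝ ℝ (Fin d → ℝ))) x := by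
  have h1 : HasFDerivAt (fun y : Fin d → ℝ => (t, y)) (ContinuousLinearMap.inr ℝ ℝ (Fin d → ℝ)) x :=
    hasFDerivAt_prodMk_right t x
  exact h.hasFDerivAt.comp x h1

lemma pd_slice {d : ℕ} {G : ℝ × (Fin d → ℝ) → ℝ} {t : ℝ} {x : Fin d → ℝ}
    (h : DifferentiableAt ℝ G (t, x)) (i : Fin d) :
    pd i (fun y => G (t, y)) x = DD (ee i) G (t, x) := by
  unfold pd
  rw [(hasFDerivAt_slice h).fderiv]
  simp [DD]

lemma slice_cont {d : ℕ} {J : Set ℝ} {G : ℝ × (Fin d → ℝ) → ℝ}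
    (h : ContinuousOn G (J ×ˢ Set.univ)) {t : ℝ} (ht : t ∈ J) : Continuous (fun x => G (t, x)) := by
  rw [← continuousOn_univ]
  exact h.comp (Continuous.continuousOn (by fun_prop)) (fun x _ => ⟨ht, trivial⟩)

lemma slice_int {d : ℕ} {J : Set ℝ} {G : ℝ × (Fin d → ℝ) → ℝ}
    (h : ContinuousOn G (J ×ˢ Set.univ)) {t : ℝ} (ht : t ∈ J) :
    IntegrableOn (fun x => G (t, x)) (Set.Icc (0 : Fin d → ℝ) 1) :=
  (slice_cont h ht).continuousOn.integrableOn_compact isCompact_Icc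

lemma int_cont {d : ℕ} {a b : ℝ} {G : ℝ × (Fin d → ℝ) → ℝ}
    (h : ContinuousOn G (Set.Icc a b ×ˢ Set.univ)) :
    ContinuousOn (fun t => ∫ x in Set.Icc (0 : Fin d → ℝ) 1, G (t, x)) (Set.Icc a b) := by
  obtain ⟨C, hC⟩ := ((isCompact_Icc (a := a) (b := b)).prod
    (isCompact_Icc (a := (0 : Fin d → ℝ)) (b := 1))).exists_bound_of_continuousOn
      (h.mono (Set.prod_mono le_rfl (Set.subset_univ _)))
  apply continuousOn_of_dominated (bound := fun _ => C)
  · intro t ht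
    exact (slice_cont h ht).aestronglyMeasurable
  · intro t ht
    refine (ae_restrict_iff' measurableSet_Icc).2 (Filter.Eventually.of_forall fun x hx => ?_)
    exact hC (t, x) ⟨ht, hx⟩
  · exact integrableOn_const (by simp [isCompact_Icc.measure_lt_top.ne])
  · refine Filter.Eventually.of_forall fun x => ?_
    exact h.comp (Continuous.continuousOn (by fun_prop)) (fun t ht => ⟨ht, trivial⟩)

lemma int_deriv {d : ℕ} {T : ℝ} {G : ℝ × (Fin d → ℝ) → ℝ} (hG : ContDiffOn ℝ 1 G (SS d T))
    {t : ℝ} (ht : t ∈ Set.Ioo 0 T) :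
    HasDerivAt (fun s => ∫ x in Set.Icc (0 : Fin d → ℝ) 1, G (s, x))
      (∫ x in Set.Icc (0 : Fin d → ℝ) 1, DD (tt d) G (t, x)) t := by
  obtain ⟨a, ha0, hat⟩ := exists_between ht.1
  obtain ⟨b, hbt, hbT⟩ := exists_between ht.2
  have hsub : Set.Icc a b ⊆ Set.Ioo 0 T := fun s hs => ⟨ha0.trans_le hs.1, hs.2.trans_lt hbT⟩
  obtain ⟨C, hC⟩ := ((isCompact_Icc (a := a) (b := b)).prod
    (isCompact_Icc (a := (0 : Fin d → ℝ)) (b := 1))).exists_bound_of_continuousOn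
      ((DD_cont hG (tt d)).mono (Set.prod_mono hsub (Set.subset_univ _)))
  refine (hasDerivAt_integral_of_dominated_loc_of_deriv_le (bound := fun _ => C)
    (F := fun s x => G (s, x)) (F' := fun s x => DD (tt d) G (s, x))
    (Icc_mem_nhds hat hbt) ?_ ?_ ?_ ?_ ?_ ?_).2
  · filter_upwards [Icc_mem_nhds hat hbt] with s hs
    exact (slice_cont hG.continuousOn (hsub hs)).aestronglyMeasurable
  · exact slice_int hG.continuousOn ht
  · exact (slice_cont (DD_cont hG (tt d)) ht).aestronglyMeasurable
  · refine (ae_restrict_iff' measurableSet_Icc).2 (Filter.Eventually.of_forall fun x hx => ?_)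
    intro s hs
    exact hC (s, x) ⟨hs, hx⟩
  · exact integrableOn_const (by simp [isCompact_Icc.measure_lt_top.ne])
  · refine Filter.Eventually.of_forall fun x s hs => ?_
    exact hasDerivAt_slice (C1_diff hG ⟨hsub hs, trivial⟩)

lemma int_DD_zero {d : ℕ} {T : ℝ} {G : ℝ × (Fin d → ℝ) → ℝ} (hG : ContDiffOn ℝ 1 G (SS d T))
    (hper : Per G) {t : ℝ} (ht : t ∈ Set.Ioo 0 T) (i : Fin d) :
    ∫ x in Set.Icc (0 : Fin d → ℝ) 1, DD (ee i) G (t, x) = 0 := by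
  obtain ⟨n, rfl⟩ : ∃ n, d = n + 1 := ⟨d - 1, by have := i.2; omega⟩
  have hs : ∀ x : Fin (n+1) → ℝ, (∑ j, (if j = i then ((fderiv ℝ G (t, x)).comp
      (ContinuousLinearMap.inr ℝ ℝ (Fin (n+1) → ℝ))) else 0) (Pi.single j 1))
      = DD (ee i) G (t, x) := by
    intro x
    rw [Finset.sum_eq_single i]
    · simp [DD]
    · intro j _ hj; simp [hj]
    · simp
  have key := integral_divergence_of_hasFDerivAt_off_countable' (E := ℝ) (0 : Fin (n+1) → ℝ) 1
    (by intro j; simp) (fun j x => if j = i then G (t, x) else 0)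
    (fun j x => if j = i then ((fderiv ℝ G (t, x)).comp
      (ContinuousLinearMap.inr ℝ ℝ (Fin (n+1) → ℝ))) else 0) ∅ Set.countable_empty ?_ ?_ ?_
  · simp only [hs] at key
    rw [key]
    apply Finset.sum_eq_zero
    intro j _
    by_cases hj : j = i
    · subst hj
      simp only [if_true]
      rw [sub_eq_zero]
      congr 1
      funext x
      have := hper t (j.insertNth (0:ℝ) x) (Pi.single j 1)
      simp only [Pi.one_apply, Pi.zero_apply]
      rw [← this]
      congr 2
      funext l
      refine Fin.succAboveCases j ?_ (fun l => ?_) l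
      · simp
      · simp
    · simp [hj]
  · intro j
    by_cases hj : j = i
    · simp only [hj, if_true]
      exact (slice_cont hG.continuousOn ht).continuousOn
    · simp only [hj, if_false]
      exact continuousOn_const
  · intro x _ j
    by_cases hj : j = i
    · simp only [hj, if_true]
      exact hasFDerivAt_slice (C1_diff hG ⟨ht, trivial⟩)
    · simp only [hj, if_false]
      exact hasFDerivAt_const _ _
  · simp only [hs]
    exact slice_int (DD_cont hG (ee i)) ht

lemma deriv_mul_nonneg_of {a b : ℝ → ℝ} {a' b' : ℝ} (ha : HasDerivAt a a' 0)
    (hb : HasDerivAt b b' 0) (h : ∀ s, 0 ≤ (a s - a 0) * (b s - b 0)) : 0 ≤ a' * b' := by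
  have h1 := hasDerivAt_iff_tendsto_slope.1 ha
  have h2 := hasDerivAt_iff_tendsto_slope.1 hb
  refine ge_of_tendsto (h1.mul h2) (Filter.Eventually.of_forall fun s => ?_)
  simp only [slope, vsub_eq_sub, smul_eq_mul, sub_zero]
  have : s⁻¹ * (a s - a 0) * (s⁻¹ * (b s - b 0)) = (s⁻¹)^2 * ((a s - a 0) * (b s - b 0)) := by ring
  rw [this]
  exact mul_nonneg (sq_nonneg _) (h s)

lemma DD_mono {d : ℕ} {T : ℝ} {M W : ℝ × (Fin d → ℝ) → ℝ} {g : ℝ → ℝ}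
    (hM : ContDiffOn ℝ 1 M (SS d T)) (hW : ContDiffOn ℝ 1 W (SS d T))
    (hg : MonotoneOn g (Set.Ici 0)) (hMnn : ∀ q, 0 ≤ M q)
    (hWg : ∀ q ∈ SS d T, W q = g (M q)) (i : Fin d) :
    ∀ q ∈ SS d T, 0 ≤ DD (ee i) M q * DD (ee i) W q := by
  rintro ⟨t, x⟩ hq
  have h1 : HasDerivAt (fun s : ℝ => (t, x) + s • (ee i : ℝ × (Fin d → ℝ))) (ee i) 0 := by
    simpa using ((hasDerivAt_id (0:ℝ)).smul_const (ee i : ℝ × (Fin d → ℝ))).const_add (t, x)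
  have h0 : (t, x) + (0:ℝ) • (ee i : ℝ × (Fin d → ℝ)) = (t, x) := by simp
  have hd : ∀ {G : ℝ × (Fin d → ℝ) → ℝ}, ContDiffOn ℝ 1 G (SS d T) →
      HasDerivAt (fun s : ℝ => G ((t, x) + s • (ee i : ℝ × (Fin d → ℝ)))) (DD (ee i) G (t, x)) 0 := by
    intro G hG
    have := (C1_diff hG hq).hasFDerivAt
    rw [← h0] at this
    have h3 := this.comp_hasDerivAt (0:ℝ) h1
    rw [h0] at h3
    exact h3
  refine deriv_mul_nonneg_of (hd hM) (hd hW) fun s => ?_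
  have hS : ∀ s : ℝ, (t, x) + s • (ee i : ℝ × (Fin d → ℝ)) ∈ SS d T := by
    intro s
    refine ⟨?_, trivial⟩
    simpa using hq.1
  rw [hWg _ (hS s), hWg _ (hS 0)]
  rcases le_total (M ((t, x) + s • (ee i))) (M ((t, x) + (0:ℝ) • (ee i))) with h | h
  · exact mul_nonneg_of_nonpos_of_nonpos (sub_nonpos.2 h)
      (sub_nonpos.2 (hg (hMnn _) (hMnn _) h))
  · exact mul_nonneg (sub_nonneg.2 h) (sub_nonneg.2 (hg (hMnn _) (hMnn _) h))

lemma pd_closed {d : ℕ} {T : ℝ} (hT : 0 < T) {F : ℝ → (Fin d → ℝ) → ℝ}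
    (hF : ContDiffOn ℝ ∞ (fun q : ℝ × (Fin d → ℝ) => F q.1 q.2) (Set.Icc 0 T ×ˢ Set.univ))
    (i : Fin d) :
    ContDiffOn ℝ ∞ (fun q : ℝ × (Fin d → ℝ) => pd i (F q.1) q.2) (Set.Icc 0 T ×ˢ Set.univ) := by
  have hu : UniqueDiffOn ℝ (Set.Icc 0 T ×ˢ (Set.univ : Set (Fin d → ℝ))) :=
    (uniqueDiffOn_Icc hT).prod uniqueDiffOn_univ
  have h1 := (hF.fderivWithin hu (m := ∞) (by simp)).clm_apply
    (contDiffOn_const (c := (ee i : ℝ × (Fin d → ℝ))))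
  refine h1.congr ?_
  rintro ⟨t, x⟩ hq
  have hd := ((hF.differentiableOn (by simp)) (t, x) hq).hasFDerivWithinAt
  have h2 : HasFDerivWithinAt (fun y : Fin d → ℝ => (t, y))
    (ContinuousLinearMap.inr ℝ ℝ (Fin d → ℝ)) Set.univ x :=
    (hasFDerivAt_prodMk_right t x).hasFDerivWithinAt
  have h3 := hd.comp x h2 (fun y _ => ⟨hq.1, trivial⟩)
  have h4 := (hasFDerivWithinAt_univ.1 h3).fderiv
  simp only [pd]
  have h5 : ((fun q : ℝ × (Fin d → ℝ) => F q.1 q.2) ∘ fun y => (t, y)) = F t := rfl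
  rw [h5] at h4
  rw [h4]
  simp

lemma pd_per {d : ℕ} {f : (Fin d → ℝ) → ℝ} (h : ∀ (x : Fin d → ℝ) (k : Fin d → ℤ),
    f (x + fun i => (k i : ℝ)) = f x) (i : Fin d) : ∀ (x : Fin d → ℝ) (k : Fin d → ℤ),
    pd i f (x + fun i => (k i : ℝ)) = pd i f x := by
  intro x k
  have h2 := fderiv_comp_add_right (𝕜 := ℝ) (f := f) (x := x) (fun i => (k i : ℝ))
  simp only [h _ k] at h2
  simp only [pd]
  rw [← h2]

lemma lap_le {d : ℕ} {T : ℝ} (hT : 0 < T) {V : ℝ → (Fin d → ℝ) → ℝ}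
    (hV : ContDiffOn ℝ ∞ (fun q : ℝ × (Fin d → ℝ) => V q.1 q.2) (Set.Icc 0 T ×ˢ Set.univ))
    (hVper : ∀ (t : ℝ) (x : Fin d → ℝ) (k : Fin d → ℤ),
      V t (x + fun i => (k i : ℝ)) = V t x) {t : ℝ} (ht : t ∈ Set.Icc 0 T) (x : Fin d → ℝ) :
    |lap (V t) x| ≤ lapVsup d T V := by
  have hc : ContinuousOn (fun q : ℝ × (Fin d → ℝ) => lap (V q.1) q.2) (Set.Icc 0 T ×ˢ Set.univ) := by
    unfold lap
    refine continuousOn_finsetSum _ fun i _ => ?_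
    exact (pd_closed hT (F := fun t => pd i (V t)) (pd_closed hT hV i) i).continuousOn
  obtain ⟨C, hC⟩ := ((isCompact_Icc (a := (0:ℝ)) (b := T)).prod
    (isCompact_Icc (a := (0 : Fin d → ℝ)) (b := 1))).exists_bound_of_continuousOn
      (hc.mono (Set.prod_mono le_rfl (Set.subset_univ _)))
  refine le_csSup ⟨C, ?_⟩ ⟨t, ht, x, rfl⟩
  rintro y ⟨s, hs, z, rfl⟩
  have hp : lap (V s) (z + fun i => ((-⌊z i⌋ : ℤ) : ℝ)) = lap (V s) z := by
    unfold lap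
    refine Finset.sum_congr rfl fun i _ => ?_
    exact pd_per (pd_per (hVper s) i) i z (fun i => -⌊z i⌋)
  rw [← hp]
  refine hC (s, _) ⟨hs, ?_⟩
  constructor
  · intro i
    have := Int.floor_le (z i)
    simp; linarith
  · intro i
    have := Int.lt_floor_add_one (z i)
    simp; linarith

lemma DD_rpow {d : ℕ} {T p : ℝ} (hp : 0 < p) {M : ℝ × (Fin d → ℝ) → ℝ}
    (hM : ContDiffOn ℝ 1 M (SS d T)) (v : ℝ × (Fin d → ℝ)) : ∀ q ∈ SS d T,
    DD v (fun q => M q ^ (p + 1)) q = (p + 1) * M q ^ p * DD v M q := by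
  intro q hq
  have := (C1_diff hM hq).hasFDerivAt.rpow_const (p := p + 1) (Or.inr (by linarith))
  unfold DD
  rw [this.fderiv]
  simp

lemma C1_rpow {d : ℕ} {T p : ℝ} (hp : 0 < p) {M : ℝ × (Fin d → ℝ) → ℝ}
    (hM : ContDiffOn ℝ 1 M (SS d T)) : ContDiffOn ℝ 1 (fun q => M q ^ (p + 1)) (SS d T) := by
  have h : ContDiff ℝ ((1 : ℕ) : ℕ∞ω) (fun x : ℝ => x ^ (p + 1)) :=
    Real.contDiff_rpow_const_of_le (by push_cast; linarith)
  exact (by exact_mod_cast h : ContDiff ℝ 1 (fun x : ℝ => x ^ (p + 1))).comp_contDiffOn hM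

noncomputable def LL {d : ℕ} (U : ℝ × (Fin d → ℝ) → ℝ) (q : ℝ × (Fin d → ℝ)) : ℝ :=
  ∑ i, DD (ee i) (DD (ee i) U) q

noncomputable def WW {d : ℕ} (U V : ℝ × (Fin d → ℝ) → ℝ) (q : ℝ × (Fin d → ℝ)) : ℝ :=
  (∑ i, DD (ee i) U q * DD (ee i) U q) / 2 + V q - DD (tt d) U q

lemma LL_smooth {d : ℕ} {T : ℝ} {U : ℝ × (Fin d → ℝ) → ℝ} (h : ContDiffOn ℝ ∞ U (SS d T)) :
    ContDiffOn ℝ ∞ (LL U) (SS d T) :=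
  ContDiffOn.sum fun i _ => DD_smooth (DD_smooth h _) _

lemma Per.LL {d : ℕ} {U : ℝ × (Fin d → ℝ) → ℝ} (h : Per U) : Per (LL U) := by
  intro t x k
  exact Finset.sum_congr rfl fun i _ => (h.DD _).DD _ t x k

lemma Per.mul {d : ℕ} {U V : ℝ × (Fin d → ℝ) → ℝ} (h : Per U) (h' : Per V) :
    Per (fun q => U q * V q) := by
  intro t x k
  simp only [h t x k, h' t x k]

lemma WW_smooth {d : ℕ} {T : ℝ} {U V : ℝ × (Fin d → ℝ) → ℝ} (h : ContDiffOn ℝ ∞ U (SS d T))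
    (h' : ContDiffOn ℝ ∞ V (SS d T)) : ContDiffOn ℝ ∞ (WW U V) (SS d T) :=
  (((ContDiffOn.sum fun i _ => (DD_smooth h (ee i)).mul (DD_smooth h (ee i))).div_const 2).add h').sub
    (DD_smooth h _)

lemma Per.WW {d : ℕ} {U V : ℝ × (Fin d → ℝ) → ℝ} (h : Per U) (h' : Per V) : Per (WW U V) := by
  intro t x k
  simp only [_root_.WW, h.DD _ t x k, h' t x k]

/-- time derivative of the Laplacian -/
lemma LL_t {d : ℕ} {T : ℝ} {U V : ℝ × (Fin d → ℝ) → ℝ} (hU : ContDiffOn ℝ ∞ U (SS d T))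
    (hV : ContDiffOn ℝ ∞ V (SS d T)) : ∀ q ∈ SS d T,
    DD (tt d) (LL U) q = (∑ i, ∑ j, DD (ee i) (DD (ee j) U) q ^ 2)
      + (∑ j, DD (ee j) U q * DD (ee j) (LL U) q) + LL V q - LL (WW U V) q := by
  have hUi : ∀ i, ContDiffOn ℝ ∞ (DD (ee i) U) (SS d T) := fun i => DD_smooth hU _
  have hUij : ∀ i j, ContDiffOn ℝ ∞ (DD (ee i) (DD (ee j) U)) (SS d T) :=
    fun i j => DD_smooth (hUi j) _
  have hW := WW_smooth hU hV
  -- `U_t`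
  have e0 : DD (tt d) U = fun q => (∑ j, (2⁻¹ * DD (ee j) U q) * DD (ee j) U q) + V q - WW U V q := by
    funext q
    simp only [WW, mul_assoc, ← Finset.mul_sum]
    ring
  have hhalf : ∀ j, ContDiffOn ℝ ∞ (fun q => 2⁻¹ * DD (ee j) U q) (SS d T) :=
    fun j => contDiffOn_const.mul (hUi j)
  have hterm : ∀ j, ContDiffOn ℝ ∞ (fun q => (2⁻¹ * DD (ee j) U q) * DD (ee j) U q) (SS d T) :=
    fun j => (hhalf j).mul (hUi j)
  have hsum : ContDiffOn ℝ ∞ (fun q => ∑ j, (2⁻¹ * DD (ee j) U q) * DD (ee j) U q) (SS d T) :=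
    ContDiffOn.sum fun j _ => hterm j
  have e1 : ∀ i, ∀ q ∈ SS d T, DD (ee i) (DD (tt d) U) q =
      (∑ j, DD (ee j) U q * DD (ee i) (DD (ee j) U) q) + DD (ee i) V q - DD (ee i) (WW U V) q := by
    intro i q hq
    rw [e0, DD_sub (C1_of (hsum.add hV)) (C1_of hW) _ q hq, DD_add (C1_of hsum) (C1_of hV) _ q hq,
      DD_sum (fun j => C1_of (hterm j)) _ q hq]
    congr 2
    refine Finset.sum_congr rfl fun j _ => ?_
    rw [DD_mul (C1_of (hhalf j)) (C1_of (hUi j)) _ q hq,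
      DD_mul contDiffOn_const (C1_of (hUi j)) _ q hq]
    have : DD (ee i) (fun _ : ℝ × (Fin d → ℝ) => (2⁻¹ : ℝ)) q = 0 := by simp [DD]
    rw [this]
    ring
  have hterm2 : ∀ i j, ContDiffOn ℝ ∞ (fun q => DD (ee j) U q * DD (ee i) (DD (ee j) U) q) (SS d T) :=
    fun i j => (hUi j).mul (hUij i j)
  have hsum2 : ∀ i, ContDiffOn ℝ ∞ (fun q => ∑ j, DD (ee j) U q * DD (ee i) (DD (ee j) U) q) (SS d T) :=
    fun i => ContDiffOn.sum fun j _ => hterm2 i j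
  intro q hq
  have e2 : ∀ i, DD (tt d) (DD (ee i) (DD (ee i) U)) q =
      (∑ j, (DD (ee i) (DD (ee j) U) q ^ 2 + DD (ee j) U q * DD (ee j) (DD (ee i) (DD (ee i) U)) q))
        + DD (ee i) (DD (ee i) V) q - DD (ee i) (DD (ee i) (WW U V)) q := by
    intro i
    rw [DD_comm (hUi i) _ _ q hq, DD_congr (DD_comm hU (tt d) (ee i)) _ q hq,
      DD_congr (e1 i) _ q hq,
      DD_sub (C1_of ((hsum2 i).add (DD_smooth hV _))) (C1_of (DD_smooth hW _)) _ q hq,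
      DD_add (C1_of (hsum2 i)) (C1_of (DD_smooth hV _)) _ q hq,
      DD_sum (fun j => C1_of (hterm2 i j)) _ q hq]
    congr 2
    refine Finset.sum_congr rfl fun j _ => ?_
    rw [DD_mul (C1_of (hUi j)) (C1_of (hUij i j)) _ q hq,
      DD_congr (DD_comm hU (ee i) (ee j)) _ q hq, DD_comm (hUi i) (ee i) (ee j) q hq]
    ring
  have e3 : ∀ v, DD v (LL U) q = ∑ i, DD v (DD (ee i) (DD (ee i) U)) q := fun v =>
    DD_sum (fun i => C1_of (hUij i i)) v q hq
  rw [e3, Finset.sum_congr rfl fun i _ => e2 i]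
  simp only [e3, Finset.sum_add_distrib, Finset.sum_sub_distrib, Finset.mul_sum, LL]
  congr 3
  exact Finset.sum_comm

section core

variable {d : ℕ} {T p : ℝ} {U V M : ℝ × (Fin d → ℝ) → ℝ}

lemma f_t (hp : 0 < p) (hM : ContDiffOn ℝ ∞ M (SS d T)) (hMnn : ∀ q, 0 ≤ M q)
    (hFP : ∀ q ∈ SS d T, DD (tt d) M q =
      ∑ i, (M q * DD (ee i) (DD (ee i) U) q + DD (ee i) M q * DD (ee i) U q)) :
    ∀ q ∈ SS d T, DD (tt d) (fun q => M q ^ (p + 1)) q =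
      (∑ i, DD (ee i) (fun q => M q ^ (p + 1)) q * DD (ee i) U q)
        + (p + 1) * (M q ^ (p + 1) * LL U q) := by
  intro q hq
  have h0 : ∀ v, DD v (fun q => M q ^ (p + 1)) q = (p + 1) * M q ^ p * DD v M q :=
    fun v => DD_rpow hp (C1_of hM) v q hq
  simp only [h0]
  rw [hFP q hq, Finset.sum_add_distrib, ← Finset.mul_sum]
  have h1 : M q ^ (p + 1) = M q ^ p * M q := Real.rpow_add_one' (hMnn q) (by linarith)
  simp only [h1, mul_assoc, ← Finset.mul_sum, LL]
  ring

lemma I_deriv (hp : 0 < p) (hU : ContDiffOn ℝ ∞ U (SS d T)) (hUp : Per U) (hMp : Per M)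
    (hM : ContDiffOn ℝ ∞ M (SS d T)) (hMnn : ∀ q, 0 ≤ M q)
    (hFP : ∀ q ∈ SS d T, DD (tt d) M q =
      ∑ i, (M q * DD (ee i) (DD (ee i) U) q + DD (ee i) M q * DD (ee i) U q))
    {t : ℝ} (ht : t ∈ Set.Ioo 0 T) :
    HasDerivAt (fun s => ∫ x in Set.Icc (0 : Fin d → ℝ) 1, M (s, x) ^ (p + 1))
      (p * ∫ x in Set.Icc (0 : Fin d → ℝ) 1, M (t, x) ^ (p + 1) * LL U (t, x)) t := by
  have hf := C1_rpow hp (C1_of hM)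
  have hfp : Per (fun q => M q ^ (p + 1)) := fun t x k => by simp only [hMp t x k]
  have hfU : ∀ i, ContDiffOn ℝ 1 (fun q => M q ^ (p + 1) * DD (ee i) U q) (SS d T) :=
    fun i => hf.mul (C1_of (DD_smooth hU _))
  have hfL : ContDiffOn ℝ 1 (fun q => M q ^ (p + 1) * LL U q) (SS d T) :=
    hf.mul (C1_of (LL_smooth hU))
  convert int_deriv hf ht using 1
  have hpt : ∀ x, DD (tt d) (fun q => M q ^ (p + 1)) (t, x) =
      (∑ i, DD (ee i) (fun q => M q ^ (p + 1) * DD (ee i) U q) (t, x))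
       + p * (M (t, x) ^ (p + 1) * LL U (t, x)) := by
    intro x
    have hq : (t, x) ∈ SS d T := ⟨ht, trivial⟩
    rw [f_t hp hM hMnn hFP _ hq, Finset.sum_congr rfl fun i _ =>
      DD_mul hf (C1_of (DD_smooth hU (ee i))) (ee i) _ hq, Finset.sum_add_distrib, ← Finset.mul_sum]
    simp only [LL]
    ring
  simp only [hpt]
  rw [integral_add, integral_finsetSum, Finset.sum_eq_zero, integral_const_mul, zero_add]
  · intro i _
    exact int_DD_zero (hfU i) (hfp.mul (hUp.DD _)) ht i
  · intro i _
    exact slice_int (DD_cont (hfU i) _) ht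
  · exact integrable_finsetSum _ fun i _ => slice_int (DD_cont (hfU i) _) ht
  · exact (slice_int hfL.continuousOn ht).const_mul p

lemma I_deriv2 (hp : 0 < p) (hU : ContDiffOn ℝ ∞ U (SS d T)) (hUp : Per U) (hMp : Per M)
    (hV : ContDiffOn ℝ ∞ V (SS d T)) (hVp : Per V)
    (hM : ContDiffOn ℝ ∞ M (SS d T)) (hMnn : ∀ q, 0 ≤ M q)
    (hFP : ∀ q ∈ SS d T, DD (tt d) M q =
      ∑ i, (M q * DD (ee i) (DD (ee i) U) q + DD (ee i) M q * DD (ee i) U q))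
    {g : ℝ → ℝ} (hg : MonotoneOn g (Set.Ici 0)) (hHJ : ∀ q ∈ SS d T, WW U V q = g (M q))
    {B : ℝ} (hB : ∀ q ∈ SS d T, |LL V q| ≤ B)
    {t : ℝ} (ht : t ∈ Set.Ioo 0 T) :
    ∃ I2 : ℝ, HasDerivAt
      (fun s => ∫ x in Set.Icc (0 : Fin d → ℝ) 1, M (s, x) ^ (p + 1) * LL U (s, x)) I2 t ∧
      - B * (∫ x in Set.Icc (0 : Fin d → ℝ) 1, M (t, x) ^ (p + 1)) ≤ I2 := by
  have hf := C1_rpow hp (C1_of hM)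
  have hfp : Per (fun q => M q ^ (p + 1)) := fun t x k => by simp only [hMp t x k]
  have hL := LL_smooth hU
  have hW := WW_smooth hU hV
  have hfL : ContDiffOn ℝ 1 (fun q => M q ^ (p + 1) * LL U q) (SS d T) := hf.mul (C1_of hL)
  have hUL : ∀ i, ContDiffOn ℝ ∞ (fun q => DD (ee i) U q * LL U q) (SS d T) :=
    fun i => (DD_smooth hU _).mul hL
  have hfUL : ∀ i, ContDiffOn ℝ 1 (fun q => M q ^ (p + 1) * (DD (ee i) U q * LL U q)) (SS d T) :=
    fun i => hf.mul (C1_of (hUL i))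
  have hfW : ∀ i, ContDiffOn ℝ 1 (fun q => M q ^ (p + 1) * DD (ee i) (WW U V) q) (SS d T) :=
    fun i => hf.mul (C1_of (DD_smooth hW _))
  refine ⟨_, int_deriv hfL ht, ?_⟩
  have hpt : ∀ x, (∑ i, DD (ee i) (fun q => M q ^ (p + 1) * (DD (ee i) U q * LL U q)) (t, x))
      - (∑ i, DD (ee i) (fun q => M q ^ (p + 1) * DD (ee i) (WW U V) q) (t, x))
      + - B * M (t, x) ^ (p + 1) ≤ DD (tt d) (fun q => M q ^ (p + 1) * LL U q) (t, x) := by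
    intro x
    have hq : (t, x) ∈ SS d T := ⟨ht, trivial⟩
    generalize (t, x) = q at hq
    rw [DD_mul hf (C1_of hL) _ q hq, f_t hp hM hMnn hFP q hq, LL_t hU hV q hq]
    have a1 : ∀ i, DD (ee i) (fun q => M q ^ (p + 1) * (DD (ee i) U q * LL U q)) q =
        M q ^ (p + 1) * (DD (ee i) U q * DD (ee i) (LL U) q)
        + (M q ^ (p + 1) * LL U q) * DD (ee i) (DD (ee i) U) q
        + (DD (ee i) (fun q => M q ^ (p + 1)) q * DD (ee i) U q) * LL U q := by
      intro i
      rw [DD_mul hf (C1_of (hUL i)) _ q hq, DD_mul (C1_of (DD_smooth hU _)) (C1_of hL) _ q hq]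
      ring
    have a2 : ∀ i, DD (ee i) (fun q => M q ^ (p + 1) * DD (ee i) (WW U V) q) q =
        M q ^ (p + 1) * DD (ee i) (DD (ee i) (WW U V)) q
        + DD (ee i) (fun q => M q ^ (p + 1)) q * DD (ee i) (WW U V) q := by
      intro i
      rw [DD_mul hf (C1_of (DD_smooth hW _)) _ q hq]
    have a3 : 0 ≤ ∑ i, DD (ee i) (fun q => M q ^ (p + 1)) q * DD (ee i) (WW U V) q := by
      refine Finset.sum_nonneg fun i _ => ?_
      rw [DD_rpow hp (C1_of hM) _ q hq, mul_assoc]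
      exact mul_nonneg (mul_nonneg (by linarith) (Real.rpow_nonneg (hMnn q) _))
        (DD_mono (C1_of hM) (C1_of hW) hg hMnn hHJ i q hq)
    simp only [a1, a2, Finset.sum_add_distrib, ← Finset.mul_sum, ← Finset.sum_mul]
    have b1 : ∑ i, DD (ee i) (DD (ee i) U) q = LL U q := rfl
    have b2 : ∑ i, DD (ee i) (DD (ee i) (WW U V)) q = LL (WW U V) q := rfl
    rw [b1, b2]
    have hf0 : 0 ≤ M q ^ (p + 1) := Real.rpow_nonneg (hMnn q) _
    have c1 : 0 ≤ M q ^ (p + 1) * ∑ i, ∑ j, DD (ee i) (DD (ee j) U) q ^ 2 :=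
      mul_nonneg hf0 (Finset.sum_nonneg fun i _ => Finset.sum_nonneg fun j _ => sq_nonneg _)
    have c2 : 0 ≤ p * (M q ^ (p + 1) * (LL U q) ^ 2) :=
      mul_nonneg hp.le (mul_nonneg hf0 (sq_nonneg _))
    have c3 : M q ^ (p + 1) * (-B) ≤ M q ^ (p + 1) * LL V q :=
      mul_le_mul_of_nonneg_left (neg_le_of_abs_le (hB q hq)) hf0
    nlinarith [c1, c2, c3, a3]
  have i1 : ∀ i, Integrable (fun x => DD (ee i) (fun q => M q ^ (p + 1) * (DD (ee i) U q * LL U q)) (t, x))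
      (volume.restrict (Set.Icc (0 : Fin d → ℝ) 1)) := fun i => slice_int (DD_cont (hfUL i) _) ht
  have i2 : ∀ i, Integrable (fun x => DD (ee i) (fun q => M q ^ (p + 1) * DD (ee i) (WW U V) q) (t, x))
      (volume.restrict (Set.Icc (0 : Fin d → ℝ) 1)) := fun i => slice_int (DD_cont (hfW i) _) ht
  have i3 : Integrable (fun x => - B * M (t, x) ^ (p + 1))
      (volume.restrict (Set.Icc (0 : Fin d → ℝ) 1)) := (slice_int hf.continuousOn ht).const_mul _
  have i12 : Integrable (fun x =>
      (∑ i, DD (ee i) (fun q => M q ^ (p + 1) * (DD (ee i) U q * LL U q)) (t, x))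
      - (∑ i, DD (ee i) (fun q => M q ^ (p + 1) * DD (ee i) (WW U V) q) (t, x)))
      (volume.restrict (Set.Icc (0 : Fin d → ℝ) 1)) := (integrable_finsetSum Finset.univ fun i _ => i1 i).sub
    (integrable_finsetSum Finset.univ fun i _ => i2 i)
  have key := integral_mono (i12.add i3) (slice_int (DD_cont hfL (tt d)) ht) hpt
  refine le_trans (le_of_eq ?_) key
  simp only [Pi.add_apply]
  rw [integral_add i12 i3, integral_sub (integrable_finsetSum Finset.univ fun i _ => i1 i)
    (integrable_finsetSum Finset.univ fun i _ => i2 i), integral_finsetSum _ fun i _ => i1 i,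
    integral_finsetSum _ fun i _ => i2 i,
    Finset.sum_eq_zero fun i _ => int_DD_zero (hfUL i) (hfp.mul ((hUp.DD _).mul hUp.LL)) ht i,
    Finset.sum_eq_zero fun i _ => int_DD_zero (hfW i) (hfp.mul ((hUp.WW hVp).DD _)) ht i,
    integral_const_mul]
  ring

end core

lemma comparison {T K : ℝ} (hT : 0 < T) (hK : 0 ≤ K) (hKT : K * T ^ 2 < 2) {I I1 : ℝ → ℝ}
    (hc : ContinuousOn I (Set.Icc 0 T)) (hnn : ∀ t, 0 ≤ I t)
    (h1 : ∀ t ∈ Set.Ioo 0 T, HasDerivAt I (I1 t) t)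
    (h2 : ∀ t ∈ Set.Ioo 0 T, ∃ I2, HasDerivAt I1 I2 t ∧ - K * I t ≤ I2) :
    ∀ t ∈ Set.Icc 0 T, I t ≤ 2 / (2 - K * T ^ 2) * (I 0 + I T) := by
  obtain ⟨s, hs, hmax⟩ := isCompact_Icc.exists_isMaxOn (Set.nonempty_Icc.2 hT.le) hc
  choose! I2 hI2 hI2' using h2
  have hconv : ConvexOn ℝ (Set.Icc 0 T) (fun t => I t + K * I s * (t ^ 2 / 2)) := by
    refine convexOn_of_hasDerivWithinAt2_nonneg (convex_Icc 0 T)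
      (f' := fun t => I1 t + K * I s * t) (f'' := fun t => I2 t + K * I s) ?_ ?_ ?_ ?_
    · exact hc.add (Continuous.continuousOn (by fun_prop))
    · rw [interior_Icc]
      intro t ht
      have : HasDerivAt (fun t : ℝ => K * I s * (t ^ 2 / 2)) (K * I s * t) t := by
        have := ((hasDerivAt_pow 2 t).div_const 2).const_mul (K * I s)
        exact this.congr_deriv (by push_cast; ring)
      exact ((h1 t ht).add this).hasDerivWithinAt
    · rw [interior_Icc]
      intro t ht
      have : HasDerivAt (fun t : ℝ => K * I s * t) (K * I s) t := by
        simpa using (hasDerivAt_id t).const_mul (K * I s)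
      exact ((hI2 t ht).add this).hasDerivWithinAt
    · rw [interior_Icc]
      intro t ht
      have a := hI2' t ht
      have b : I t ≤ I s := hmax ⟨ht.1.le, ht.2.le⟩
      have := mul_le_mul_of_nonneg_left b hK
      linarith
  have hle := hconv.le_max_of_mem_Icc (Set.left_mem_Icc.2 hT.le) (Set.right_mem_Icc.2 hT.le) hs
  have hle2 : I s ≤ I 0 + I T + K * I s * (T ^ 2 / 2) := by
    have hKI := mul_nonneg hK (hnn s)
    have p1 := mul_nonneg hKI (by positivity : 0 ≤ s ^ 2 / 2)
    have p2 := mul_nonneg hKI (by positivity : 0 ≤ T ^ 2 / 2)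
    have := hnn 0
    have := hnn T
    rcases le_max_iff.1 hle with h | h
    · linarith
    · linarith
  intro t ht
  have b : I t ≤ I s := hmax ht
  refine b.trans ?_
  rw [div_mul_eq_mul_div, le_div_iff₀ (by linarith)]
  linarith

theorem lq_bound_density
    (T : ℝ) (hT : 0 < T) (d : ℕ) (hd : 1 ≤ d)
    (V : ℝ → (Fin d → ℝ) → ℝ)
    (hV : ContDiffOn ℝ (⊤ : ℕ∞) (fun q : ℝ × (Fin d → ℝ) => V q.1 q.2)
      (Set.Icc (0 : ℝ) T ×ˢ (Set.univ : Set (Fin d → ℝ))))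
    (hVper : ∀ (t : ℝ) (x : Fin d → ℝ) (k : Fin d → ℤ),
      V t (x + fun i => (k i : ℝ)) = V t x)
    (g : ℝ → ℝ) (hg : ContDiffOn ℝ (⊤ : ℕ∞) g (Set.Ici 0)) (hgmono : MonotoneOn g (Set.Ici 0))
    (m₀ mT : (Fin d → ℝ) → ℝ)
    (hm₀sm : ContDiff ℝ (⊤ : ℕ∞) m₀) (hmTsm : ContDiff ℝ (⊤ : ℕ∞) mT)
    (hm₀per : ∀ (x : Fin d → ℝ) (k : Fin d → ℤ), m₀ (x + fun i => (k i : ℝ)) = m₀ x)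
    (hmTper : ∀ (x : Fin d → ℝ) (k : Fin d → ℤ), mT (x + fun i => (k i : ℝ)) = mT x)
    (hm₀nn : ∀ x, 0 ≤ m₀ x) (hmTnn : ∀ x, 0 ≤ mT x)
    (hm₀pr : ∫ x in Set.Icc (0 : Fin d → ℝ) 1, m₀ x = 1)
    (hmTpr : ∫ x in Set.Icc (0 : Fin d → ℝ) 1, mT x = 1)
    (u m : ℝ → (Fin d → ℝ) → ℝ)
    (hu : ContDiffOn ℝ (⊤ : ℕ∞) (fun q : ℝ × (Fin d → ℝ) => u q.1 q.2)
      (Set.Icc (0 : ℝ) T ×ˢ (Set.univ : Set (Fin d → ℝ))))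
    (hm : ContDiffOn ℝ (⊤ : ℕ∞) (fun q : ℝ × (Fin d → ℝ) => m q.1 q.2)
      (Set.Icc (0 : ℝ) T ×ˢ (Set.univ : Set (Fin d → ℝ))))
    (huper : ∀ (t : ℝ) (x : Fin d → ℝ) (k : Fin d → ℤ),
      u t (x + fun i => (k i : ℝ)) = u t x)
    (hmper : ∀ (t : ℝ) (x : Fin d → ℝ) (k : Fin d → ℤ),
      m t (x + fun i => (k i : ℝ)) = m t x)
    (hmnn : ∀ t x, 0 ≤ m t x)
    (hHJ : ∀ t ∈ Set.Ioo (0 : ℝ) T, ∀ x,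
      -(deriv (fun s => u s x) t) + (∑ i, (pd i (u t) x) ^ 2) / 2 + V t x = g (m t x))
    (hFP : ∀ t ∈ Set.Ioo (0 : ℝ) T, ∀ x,
      deriv (fun s => m s x) t = ∑ i, pd i (fun y => m t y * pd i (u t) y) x)
    (hini : ∀ x, m 0 x = m₀ x) (hter : ∀ x, m T x = mT x)
    (p : ℝ) (hp : 0 < p)
    (hVsmall : lapVsup d T V < 2 / T ^ 2 * (1 / p)) :
    ∀ t ∈ Set.Icc (0 : ℝ) T,
      ∫ x in Set.Icc (0 : Fin d → ℝ) 1, m t x ^ (p + 1) ≤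
        2 / (2 - p * T ^ 2 * lapVsup d T V) *
          ((∫ x in Set.Icc (0 : Fin d → ℝ) 1, m₀ x ^ (p + 1)) +
            ∫ x in Set.Icc (0 : Fin d → ℝ) 1, mT x ^ (p + 1)) := by
  have hsub : SS d T ⊆ Set.Icc (0 : ℝ) T ×ˢ (Set.univ : Set (Fin d → ℝ)) :=
    Set.prod_mono Set.Ioo_subset_Icc_self le_rfl
  set U : ℝ × (Fin d → ℝ) → ℝ := fun q => u q.1 q.2 with hUdef
  set M : ℝ × (Fin d → ℝ) → ℝ := fun q => m q.1 q.2 with hMdef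
  set W : ℝ × (Fin d → ℝ) → ℝ := fun q => V q.1 q.2 with hWdef
  have hU' : ContDiffOn ℝ ∞ U (SS d T) := hu.mono hsub
  have hM' : ContDiffOn ℝ ∞ M (SS d T) := hm.mono hsub
  have hV' : ContDiffOn ℝ ∞ W (SS d T) := hV.mono hsub
  have hUp : Per U := huper
  have hMp : Per M := hmper
  have hVp : Per W := hVper
  have hMnn : ∀ q, 0 ≤ M q := fun q => hmnn _ _
  have pdU : ∀ t ∈ Set.Ioo (0:ℝ) T, ∀ x i, pd i (u t) x = DD (ee i) U (t, x) := fun t ht x i =>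
    pd_slice (C1_diff (C1_of hU') ⟨ht, trivial⟩) i
  have hFP' : ∀ q ∈ SS d T, DD (tt d) M q =
      ∑ i, (M q * DD (ee i) (DD (ee i) U) q + DD (ee i) M q * DD (ee i) U q) := by
    rintro ⟨t, x⟩ hq
    have h1 := (hasDerivAt_slice (C1_diff (C1_of hM') hq)).deriv
    rw [← h1]
    refine (hFP t hq.1 x).trans (Finset.sum_congr rfl fun i _ => ?_)
    have h2 : (fun y => m t y * pd i (u t) y) = fun y => (fun q => M q * DD (ee i) U q) (t, y) := by
      funext y
      simp only [pdU t hq.1]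
      rfl
    have hUi := C1_of (DD_smooth hU' (ee i))
    rw [h2, pd_slice (C1_diff ((C1_of hM').mul hUi) hq) i, DD_mul (C1_of hM') hUi _ _ hq]
  have hHJ' : ∀ q ∈ SS d T, WW U W q = g (M q) := by
    rintro ⟨t, x⟩ hq
    have h1 := (hasDerivAt_slice (C1_diff (C1_of hU') hq)).deriv
    have h2 := hHJ t hq.1 x
    have h3 : deriv (fun s => u s x) t = DD (tt d) U (t, x) := h1
    rw [h3] at h2
    simp only [pdU t hq.1, pow_two] at h2
    have h4 : g (M (t, x)) = g (m t x) := rfl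
    rw [h4, ← h2]
    simp only [WW]
    have h5 : W (t, x) = V t x := rfl
    rw [h5]
    ring
  have hB : ∀ q ∈ SS d T, |LL W q| ≤ lapVsup d T V := by
    rintro ⟨t, x⟩ hq
    have h1 : LL W (t, x) = lap (V t) x := by
      unfold LL lap
      refine Finset.sum_congr rfl fun i _ => ?_
      have h2 : pd i (V t) = fun y => DD (ee i) W (t, y) := by
        funext y
        exact pd_slice (t := t) (x := y) (C1_diff (C1_of hV') ⟨hq.1, trivial⟩) i
      rw [h2, pd_slice (C1_diff (C1_of (DD_smooth hV' _)) hq) i]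
    rw [h1]
    exact lap_le hT hV hVper (Set.Ioo_subset_Icc_self hq.1) x
  have hB0 : 0 ≤ lapVsup d T V := by
    apply Real.sSup_nonneg
    rintro y ⟨_, _, _, rfl⟩
    exact abs_nonneg _
  have hKT : (p * lapVsup d T V) * T ^ 2 < 2 := by
    have hpT : 0 < p * T ^ 2 := by positivity
    have h1 := mul_lt_mul_of_pos_left hVsmall hpT
    have h2 : p * T ^ 2 * (2 / T ^ 2 * (1 / p)) = 2 := by field_simp
    rw [h2] at h1
    linarith
  have key := comparison hT (mul_nonneg hp.le hB0) hKT
    (I := fun t => ∫ x in Set.Icc (0 : Fin d → ℝ) 1, M (t, x) ^ (p + 1))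
    (I1 := fun t => p * ∫ x in Set.Icc (0 : Fin d → ℝ) 1, M (t, x) ^ (p + 1) * LL U (t, x))
    (int_cont (G := fun q => M q ^ (p + 1))
      (hm.continuousOn.rpow_const fun _ _ => Or.inr (by linarith)))
    (fun t => integral_nonneg fun x => Real.rpow_nonneg (hMnn _) _)
    (fun t ht => I_deriv hp hU' hUp hMp hM' hMnn hFP' ht)
    (fun t ht => by
      obtain ⟨I2, h1, h2⟩ := I_deriv2 hp hU' hUp hMp hV' hVp hM' hMnn hFP' hgmono hHJ' hB ht
      refine ⟨p * I2, h1.const_mul p, ?_⟩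
      have := mul_le_mul_of_nonneg_left h2 hp.le
      linarith)
  intro t ht
  have := key t ht
  simp only [hMdef, hini, hter] at this
  rw [show p * T ^ 2 * lapVsup d T V = p * lapVsup d T V * T ^ 2 by ring]
  exact this
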